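/- Let μ ∈ Δ⁺_l with μ ≠ θ. Then γ is a generator of I(μ)_min if and only if γ = w_μ⁻¹(μ + α) for some α ∈ Π with μ + α ∈ Δ (equivalently, (α, μ∨) = −1); moreover, the assignment α ↦ w_μ⁻¹(μ + α) is a bijection from {α ∈ Π : μ + α ∈ Δ} onto the set of generators of I(μ)_min. -/

import Mathlib

open scoped BigOperators

/-- Data of a reduced irreducible crystallographic root system `Δ`, spanning a
`ℚ`-vector space `V` equipped with a Weyl-group-invariant inner product `B`,
together with a chosen system of positive roots `Pos` and the highest root `θ`. -/
structure RootSystemCtx (V : Type*) [AddCommGroup V] [Module ℚ V] where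
  /-- the invariant inner product `( , )` -/
  B : V →ₗ[ℚ] V →ₗ[ℚ] ℚ
  B_symm : ∀ x y : V, B x y = B y x
  B_posdef : ∀ x : V, x ≠ 0 → 0 < B x x
  /-- the set of roots -/
  Δ : Set V
  Δ_finite : Δ.Finite
  Δ_spans : Submodule.span ℚ Δ = ⊤
  zero_notMem_Δ : (0 : V) ∉ Δ
  neg_mem_Δ : ∀ α ∈ Δ, -α ∈ Δ
  reduced : ∀ α ∈ Δ, ∀ c : ℚ, c • α ∈ Δ → c = 1 ∨ c = -1
  crystallographic : ∀ α ∈ Δ, ∀ β ∈ Δ, ∃ n : ℤ, 2 * B α β / B β β = (n : ℚ)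
  reflect_mem : ∀ α ∈ Δ, ∀ β ∈ Δ, β - (2 * B β α / B α α) • α ∈ Δ
  irreducible : ∀ S : Set V, S ⊆ Δ → (∀ α ∈ S, ∀ β ∈ Δ \ S, B α β = 0) → S = ∅ ∨ S = Δ
  /-- the positive roots `Δ⁺` -/
  Pos : Set V
  pos_subset : Pos ⊆ Δ
  mem_pos_or_neg_pos : ∀ α ∈ Δ, α ∈ Pos ∨ -α ∈ Pos
  pos_not_neg : ∀ α ∈ Pos, -α ∉ Pos
  add_pos_mem : ∀ α ∈ Pos, ∀ β ∈ Pos, α + β ∈ Δ → α + β ∈ Pos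
  /-- the highest root `θ` -/
  θ : V
  θ_pos : θ ∈ Pos
  θ_highest : ∀ ν ∈ Δ, θ - ν ∈ AddSubmonoid.closure Pos

namespace RootSystemCtx

variable {V : Type*} [AddCommGroup V] [Module ℚ V] (ctx : RootSystemCtx V)

/-- the simple roots `Π`: indecomposable positive roots -/
def simple : Set V :=
  {α | α ∈ ctx.Pos ∧ ¬∃ β ∈ ctx.Pos, ∃ γ ∈ ctx.Pos, α = β + γ}

/-- `ρ`, the half-sum of all positive roots -/
noncomputable def ρ : V :=
  (1 / 2 : ℚ) • ∑ α ∈ (ctx.Δ_finite.subset ctx.pos_subset).toFinset, α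

/-- the coroot `μ∨ = 2μ/(μ,μ)` -/
noncomputable def coroot (μ : V) : V := (2 / ctx.B μ μ) • μ

/-- `Δ⁺_l`, the long positive roots (roots of the same length as `θ`) -/
def PosLong : Set V := {μ | μ ∈ ctx.Pos ∧ ctx.B μ μ = ctx.B ctx.θ ctx.θ}

/-- `Π_l`, the long simple roots -/
def SimpleLong : Set V := {μ | μ ∈ ctx.simple ∧ ctx.B μ μ = ctx.B ctx.θ ctx.θ}

/-- the dominance order `μ ≼ ν` on the root lattice: `ν - μ` is a nonnegative
integer combination of positive roots -/
def le (μ ν : V) : Prop := ν - μ ∈ AddSubmonoid.closure ctx.Pos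

/-- a (combinatorial) abelian ideal of `Δ⁺` -/
def IsAbelianIdeal (I : Set V) : Prop :=
  I ⊆ ctx.Pos ∧ (∀ μ ∈ I, ∀ ν ∈ I, μ + ν ∉ ctx.Δ) ∧
    ∀ γ ∈ I, ∀ ν ∈ ctx.Pos, γ + ν ∈ ctx.Δ → γ + ν ∈ I

/-- `γ` is a generator of the ideal `I` -/
def IsGenerator (I : Set V) (γ : V) : Prop := γ ∈ I ∧ ∀ α ∈ ctx.Pos, γ - α ∉ I

/-! ### The affine picture: `V̂ = V ⊕ ℚδ ⊕ ℚλ`, modelled as `V × ℚ × ℚ`,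
with `δ = (0,1,0)` and `λ = (0,0,1)`. -/

/-- the embedding of `V` into `V̂` -/
def emb (_ctx : RootSystemCtx V) (v : V) : V × ℚ × ℚ := (v, 0, 0)

/-- the imaginary root `δ` -/
def δhat (_ctx : RootSystemCtx V) : V × ℚ × ℚ := (0, 1, 0)

/-- the affine simple root `α₀ = δ - θ` -/
def alpha0 : V × ℚ × ℚ := (-ctx.θ, 1, 0)

/-- the extension of the inner product to `V̂`, with
`(δ,V)=(λ,V)=(δ,δ)=(λ,λ)=0` and `(δ,λ)=1` -/
noncomputable def Bhat : (V × ℚ × ℚ) →ₗ[ℚ] (V × ℚ × ℚ) →ₗ[ℚ] ℚ :=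
  LinearMap.mk₂ ℚ (fun x y => ctx.B x.1 y.1 + x.2.1 * y.2.2 + x.2.2 * y.2.1)
    (fun x x' y => by
      simp only [Prod.fst_add, Prod.snd_add, map_add, LinearMap.add_apply]; ring)
    (fun c x y => by
      simp only [Prod.smul_fst, Prod.smul_snd, map_smul, LinearMap.smul_apply,
        smul_eq_mul]; ring)
    (fun x y y' => by
      simp only [Prod.fst_add, Prod.snd_add, map_add]; ring)
    (fun c x y => by
      simp only [Prod.smul_fst, Prod.smul_snd, map_smul, smul_eq_mul]; ring)

/-- the set `Δ̂` of affine real roots -/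
def Δhat : Set (V × ℚ × ℚ) := {x | ∃ α ∈ ctx.Δ, ∃ k : ℤ, x = (α, (k : ℚ), 0)}

/-- the set `Δ̂⁺` of positive affine roots -/
def PosHat : Set (V × ℚ × ℚ) :=
  {x | ∃ α ∈ ctx.Pos, x = (α, 0, 0)} ∪
    {x | ∃ α ∈ ctx.Δ, ∃ k : ℤ, 1 ≤ k ∧ x = (α, (k : ℚ), 0)}

/-- the set `Π̂ = Π ∪ {α₀}` of affine simple roots -/
def SimpleHat : Set (V × ℚ × ℚ) :=
  {x | ∃ α ∈ ctx.simple, x = (α, (0 : ℚ), (0 : ℚ))} ∪ {ctx.alpha0}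

/-- the reflection `s_β : x ↦ x − (2(x,β)/(β,β))·β` in `V̂` -/
noncomputable def refl (β : V × ℚ × ℚ) : (V × ℚ × ℚ) ≃ₗ[ℚ] (V × ℚ × ℚ) :=
  if h : ctx.Bhat β β = 0 then LinearEquiv.refl ℚ _
  else
    Module.reflection (x := β) (f := (2 / ctx.Bhat β β) • ctx.Bhat β)
      (by simp only [LinearMap.smul_apply, smul_eq_mul]; field_simp)

/-- the affine Weyl group `Ŵ`, generated by the reflections `s_β`, `β ∈ Δ̂` -/
def What : Subgroup ((V × ℚ × ℚ) ≃ₗ[ℚ] (V × ℚ × ℚ)) :=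
  Subgroup.closure {g | ∃ β ∈ ctx.Δhat, g = ctx.refl β}

/-- the finite Weyl group `W`, generated by the reflections `s_α`, `α ∈ Δ`
(identified with a subgroup of `Ŵ`) -/
def Wfin : Subgroup ((V × ℚ × ℚ) ≃ₗ[ℚ] (V × ℚ × ℚ)) :=
  Subgroup.closure {g | ∃ α ∈ ctx.Δ, g = ctx.refl (α, (0 : ℚ), (0 : ℚ))}

/-- `N̂(w) = {β ∈ Δ̂⁺ : w(β) ∈ −Δ̂⁺}` -/
def Nhat (w : (V × ℚ × ℚ) ≃ₗ[ℚ] (V × ℚ × ℚ)) : Set (V × ℚ × ℚ) :=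
  {β | β ∈ ctx.PosHat ∧ -(w β) ∈ ctx.PosHat}

/-- a minuscule element of `Ŵ`: every element of `N̂(w)` has the form `δ - γ`
with `γ ∈ Δ⁺` -/
def IsMinuscule (w : (V × ℚ × ℚ) ≃ₗ[ℚ] (V × ℚ × ℚ)) : Prop :=
  w ∈ ctx.What ∧ ∀ β ∈ ctx.Nhat w, ∃ γ ∈ ctx.Pos, β = ctx.δhat - ctx.emb γ

/-- the abelian ideal `I_w` corresponding to a minuscule element `w` -/
def idealOf (w : (V × ℚ × ℚ) ≃ₗ[ℚ] (V × ℚ × ℚ)) : Set V :=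
  {γ | γ ∈ ctx.Pos ∧ ctx.δhat - ctx.emb γ ∈ ctx.Nhat w}

/-- the ideal `I` has rootlet `τ(I) = μ`, i.e. `I = I_w` for some minuscule `w`
with `w(α₀) + δ = μ` -/
def HasRootlet (I : Set V) (μ : V) : Prop :=
  ∃ w, ctx.IsMinuscule w ∧ ctx.idealOf w = I ∧ w ctx.alpha0 + ctx.δhat = ctx.emb μ

/-- `Ab_μ`, the set of nonempty abelian ideals with rootlet `μ` -/
def AbFiber (μ : V) : Set (Set V) := {I | I.Nonempty ∧ ctx.HasRootlet I μ}

/-- `N(u) = {γ ∈ Δ⁺ : u(γ) ∈ −Δ⁺}` for `u` in the finite Weyl group -/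
def Nfin (w : (V × ℚ × ℚ) ≃ₗ[ℚ] (V × ℚ × ℚ)) : Set V :=
  {γ | γ ∈ ctx.Pos ∧ -(w (ctx.emb γ)) ∈ ctx.PosHat}

/-- the length `l(u) = #N(u)` of an element of the finite Weyl group -/
noncomputable def lenFin (w : (V × ℚ × ℚ) ≃ₗ[ℚ] (V × ℚ × ℚ)) : ℕ :=
  (ctx.Nfin w).ncard

/-! ### Root system preliminaries -/

lemma ne_zero_of_mem {a : V} (ha : a ∈ ctx.Δ) : a ≠ 0 :=
  fun h => ctx.zero_notMem_Δ (h ▸ ha)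

lemma B_self_pos {a : V} (ha : a ∈ ctx.Δ) : 0 < ctx.B a a :=
  ctx.B_posdef a (ctx.ne_zero_of_mem ha)

lemma eq_zero_of_B_self_nonpos {x : V} (h : ctx.B x x ≤ 0) : x = 0 := by
  by_contra hx
  exact absurd (ctx.B_posdef x hx) (not_lt.mpr h)

lemma exists_pairing {a b : V} (ha : a ∈ ctx.Δ) (hb : b ∈ ctx.Δ) :
    ∃ n : ℤ, 2 * ctx.B a b = n * ctx.B b b := by
  obtain ⟨n, hn⟩ := ctx.crystallographic a ha b hb
  refine ⟨n, ?_⟩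
  rw [← hn, div_mul_cancel₀ _ (ctx.B_self_pos hb).ne']

lemma reflect_mem_of_pairing {a b : V} (ha : a ∈ ctx.Δ) (hb : b ∈ ctx.Δ) {n : ℚ}
    (hn : 2 * ctx.B a b = n * ctx.B b b) : a - n • b ∈ ctx.Δ := by
  have h := ctx.reflect_mem b hb a ha
  rwa [hn, mul_div_cancel_right₀ _ (ctx.B_self_pos hb).ne'] at h

lemma sub_mem_of_B_pos {a b : V} (ha : a ∈ ctx.Δ) (hb : b ∈ ctx.Δ) (h : 0 < ctx.B a b)
    (hne : a ≠ b) : a - b ∈ ctx.Δ := by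
  obtain ⟨n, hn⟩ := ctx.exists_pairing ha hb
  obtain ⟨m, hm⟩ := ctx.exists_pairing hb ha
  have hpa := ctx.B_self_pos ha
  have hpb := ctx.B_self_pos hb
  have hs := ctx.B_symm a b
  have hn0 : 0 < n := by
    by_contra hc
    have : (n : ℚ) ≤ 0 := by exact_mod_cast not_lt.mp hc
    nlinarith
  have hm0 : 0 < m := by
    by_contra hc
    have : (m : ℚ) ≤ 0 := by exact_mod_cast not_lt.mp hc
    nlinarith
  rcases eq_or_lt_of_le (Int.add_one_le_iff.mpr hn0) with h1 | h1
  · have h1' : (n : ℚ) = 1 := by exact_mod_cast h1.symm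
    have := ctx.reflect_mem_of_pairing ha hb hn
    rwa [h1', one_smul] at this
  rcases eq_or_lt_of_le (Int.add_one_le_iff.mpr hm0) with h2 | h2
  · have h2' : (m : ℚ) = 1 := by exact_mod_cast h2.symm
    have := ctx.reflect_mem_of_pairing hb ha hm
    rw [h2', one_smul] at this
    simpa using ctx.neg_mem_Δ _ this
  exfalso
  have h1' : (2 : ℚ) ≤ n := by exact_mod_cast h1
  have h2' : (2 : ℚ) ≤ m := by exact_mod_cast h2
  apply hne
  rw [← sub_eq_zero]
  apply ctx.eq_zero_of_B_self_nonpos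
  simp only [map_sub, LinearMap.sub_apply]
  nlinarith

lemma add_mem_of_B_neg {a b : V} (ha : a ∈ ctx.Δ) (hb : b ∈ ctx.Δ) (h : ctx.B a b < 0)
    (hne : a ≠ -b) : a + b ∈ ctx.Δ := by
  have := ctx.sub_mem_of_B_pos ha (ctx.neg_mem_Δ b hb) (by simpa using h) hne
  simpa using this

lemma ne_neg_of_pos {a b : V} (ha : a ∈ ctx.Pos) (hb : b ∈ ctx.Pos) : a ≠ -b :=
  fun h => ctx.pos_not_neg b hb (h ▸ ha)

lemma add_pos_of_B_neg {a b : V} (ha : a ∈ ctx.Pos) (hb : b ∈ ctx.Pos) (h : ctx.B a b < 0) :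
    a + b ∈ ctx.Pos :=
  ctx.add_pos_mem a ha b hb (ctx.add_mem_of_B_neg (ctx.pos_subset ha) (ctx.pos_subset hb) h
    (ctx.ne_neg_of_pos ha hb))

/-- A sum of positive roots vanishes only if it is empty. -/
lemma multiset_eq_zero_of_sum_eq_zero (m : Multiset V) (hm : ∀ x ∈ m, x ∈ ctx.Pos)
    (hs : m.sum = 0) : m = 0 := by
  classical
  induction hn : m.card generalizing m with
  | zero => exact Multiset.card_eq_zero.mp hn
  | succ n ih =>
    obtain ⟨a, ham⟩ := Multiset.exists_mem_of_ne_zero (s := m) (by rintro rfl; simp at hn)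
    obtain ⟨l, rfl⟩ := Multiset.exists_cons_of_mem ham
    exfalso
    rw [Multiset.sum_cons] at hs
    have ha : a ∈ ctx.Pos := hm a (Multiset.mem_cons_self a l)
    have hneg : ∃ b ∈ l, ctx.B a b < 0 := by
      by_contra! hc
      have h0 : 0 ≤ ctx.B a l.sum := by
        rw [map_multiset_sum]
        apply Multiset.sum_nonneg
        intro x hx
        obtain ⟨b, hb, rfl⟩ := Multiset.mem_map.mp hx
        exact hc b hb
      have h1 : l.sum = -a := by rw [eq_neg_iff_add_eq_zero, add_comm]; exact hs
      rw [h1, map_neg] at h0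
      linarith [ctx.B_self_pos (ctx.pos_subset ha)]
    obtain ⟨b, hb, hab⟩ := hneg
    obtain ⟨l', rfl⟩ := Multiset.exists_cons_of_mem hb
    have hbp : b ∈ ctx.Pos := hm b (Multiset.mem_cons_of_mem hb)
    have := ih ((a + b) ::ₘ l') (by
      intro x hx
      rcases Multiset.mem_cons.mp hx with rfl | hx
      · exact ctx.add_pos_of_B_neg ha hbp hab
      · exact hm x (Multiset.mem_cons_of_mem (Multiset.mem_cons_of_mem hx)))
      (by rw [Multiset.sum_cons, ← hs, Multiset.sum_cons, add_assoc])
      (by simpa using hn)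
    simp at this

lemma eq_zero_of_mem_closure_of_neg_mem {x : V} (h : x ∈ AddSubmonoid.closure ctx.Pos)
    (h' : -x ∈ AddSubmonoid.closure ctx.Pos) : x = 0 := by
  obtain ⟨m, hm, rfl⟩ := AddSubmonoid.exists_multiset_of_mem_closure h
  obtain ⟨m', hm', h2⟩ := AddSubmonoid.exists_multiset_of_mem_closure h'
  have := ctx.multiset_eq_zero_of_sum_eq_zero (m + m')
    (fun x hx => (Multiset.mem_add.mp hx).elim (hm x) (hm' x)) (by simp [h2])
  rw [(add_eq_zero.mp this).1, Multiset.sum_zero]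

/-- The strict dominance order. -/
def slt (a b : V) : Prop := b - a ≠ 0 ∧ b - a ∈ AddSubmonoid.closure ctx.Pos

instance : IsStrictOrder V ctx.slt where
  irrefl a h := h.1 (sub_self a)
  trans a b c h1 h2 := by
    have h : c - a = (b - a) + (c - b) := by abel
    refine ⟨fun h0 => h1.1 ?_, h ▸ add_mem h1.2 h2.2⟩
    refine ctx.eq_zero_of_mem_closure_of_neg_mem h1.2 ?_
    have : -(b - a) = c - b := by rw [neg_eq_iff_add_eq_zero, ← h, h0]
    exact this ▸ h2.2

lemma slt_add {a b : V} (hb : b ∈ ctx.Pos) : ctx.slt a (a + b) := by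
  refine ⟨?_, ?_⟩
  · simpa using ctx.ne_zero_of_mem (ctx.pos_subset hb)
  · simpa using AddSubmonoid.subset_closure hb

lemma exists_slt_minimal {S : Set V} (hS : S ⊆ ctx.Δ) (hne : S.Nonempty) :
    ∃ a ∈ S, ∀ b ∈ S, ¬ ctx.slt b a := by
  have hw : S.WellFoundedOn ctx.slt := (ctx.Δ_finite.subset hS).wellFoundedOn
  obtain ⟨a, ha⟩ := hne
  obtain ⟨m, -, hm⟩ := WellFounded.has_min hw Set.univ ⟨⟨a, ha⟩, trivial⟩
  exact ⟨m, m.2, fun b hb => hm ⟨b, hb⟩ trivial⟩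

lemma exists_slt_maximal {S : Set V} (hS : S ⊆ ctx.Δ) (hne : S.Nonempty) :
    ∃ a ∈ S, ∀ b ∈ S, ¬ ctx.slt a b := by
  obtain ⟨a, ha, hmin⟩ := ctx.exists_slt_minimal (S := {x | -x ∈ S})
    (fun x hx => by simpa using ctx.neg_mem_Δ _ (hS hx)) (by
      obtain ⟨a, ha⟩ := hne
      exact ⟨-a, by simpa using ha⟩)
  refine ⟨-a, ha, fun b hb h => hmin (-b) (by simpa using hb) ?_⟩
  have h1 : a - -b = b - -a := by abel
  exact ⟨h1 ▸ h.1, h1 ▸ h.2⟩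

lemma B_nonneg_of_mem_closure {x y : V} (hx : ∀ a ∈ ctx.Pos, 0 ≤ ctx.B x a)
    (hy : y ∈ AddSubmonoid.closure ctx.Pos) : 0 ≤ ctx.B x y := by
  induction hy using AddSubmonoid.closure_induction with
  | mem a ha => exact hx a ha
  | zero => simp
  | add a b _ _ iha ihb => rw [map_add]; exact add_nonneg iha ihb

lemma θ_mem : ctx.θ ∈ ctx.Δ := ctx.pos_subset ctx.θ_pos

lemma θ_dominant {a : V} (ha : a ∈ ctx.Pos) : 0 ≤ ctx.B ctx.θ a := by
  by_contra! hc
  have h := ctx.add_pos_of_B_neg ctx.θ_pos ha hc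
  have h1 := ctx.θ_highest _ (ctx.pos_subset h)
  rw [sub_add_cancel_left] at h1
  exact ctx.ne_zero_of_mem (ctx.pos_subset ha)
    (ctx.eq_zero_of_mem_closure_of_neg_mem (AddSubmonoid.subset_closure ha) h1)

lemma pos_of_B_θ_pos {a : V} (ha : a ∈ ctx.Δ) (h : 0 < ctx.B a ctx.θ) : a ∈ ctx.Pos := by
  refine (ctx.mem_pos_or_neg_pos a ha).resolve_right fun hn => ?_
  have := ctx.θ_dominant hn
  rw [map_neg, ctx.B_symm] at this
  linarith

lemma B_self_le {a : V} (ha : a ∈ ctx.Δ) : ctx.B a a ≤ ctx.B ctx.θ ctx.θ := by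
  obtain ⟨b, ⟨hb, hba⟩, hmax⟩ := ctx.exists_slt_maximal
    (S := {b | b ∈ ctx.Δ ∧ ctx.B b b = ctx.B a a}) (fun x hx => hx.1) ⟨a, ha, rfl⟩
  have hdom : ∀ c ∈ ctx.Pos, 0 ≤ ctx.B b c := by
    intro c hc
    by_contra! hneg
    have hcc := ctx.B_self_pos (ctx.pos_subset hc)
    obtain ⟨n, hn⟩ := ctx.exists_pairing hb (ctx.pos_subset hc)
    have hn0 : n < 0 := by
      by_contra hge
      have : (0 : ℚ) ≤ n := by exact_mod_cast not_lt.mp hge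
      nlinarith
    obtain ⟨k, hk⟩ := Int.eq_ofNat_of_zero_le (a := -n) (by omega)
    refine hmax (b - (n : ℚ) • c)
      ⟨ctx.reflect_mem_of_pairing hb (ctx.pos_subset hc) hn, ?_⟩ ?_
    · simp only [map_sub, LinearMap.sub_apply, map_smul, LinearMap.smul_apply, smul_eq_mul,
        ctx.B_symm c b]
      rw [← hba]
      linear_combination (-(n : ℚ)) * hn
    · have h1 : b - (n : ℚ) • c - b = k • c := by
        rw [sub_sub_cancel_left, ← neg_smul, ← Nat.cast_smul_eq_nsmul ℚ]
        congr 1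
        exact_mod_cast hk
      refine ⟨?_, ?_⟩
      · rw [h1]
        rw [← Nat.cast_smul_eq_nsmul ℚ]
        exact smul_ne_zero (by exact_mod_cast (by omega : k ≠ 0))
          (ctx.ne_zero_of_mem (ctx.pos_subset hc))
      · rw [h1]
        exact nsmul_mem (AddSubmonoid.subset_closure hc) k
  have h1 := ctx.B_nonneg_of_mem_closure hdom (ctx.θ_highest b hb)
  have h2 := ctx.B_nonneg_of_mem_closure (fun c hc => ctx.θ_dominant hc) (ctx.θ_highest b hb)
  rw [map_sub] at h1 h2
  rw [ctx.B_symm ctx.θ b] at h2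
  linarith

lemma exists_long_pairing {a ν : V} (ha : a ∈ ctx.Δ) (hν : ν ∈ ctx.Δ)
    (hl : ctx.B ν ν = ctx.B ctx.θ ctx.θ) :
    ∃ n : ℤ, 2 * ctx.B a ν = n * ctx.B ν ν ∧ -2 ≤ n ∧ n ≤ 2 ∧ (n = -2 → a = -ν) ∧
      (n = 2 → a = ν) := by
  obtain ⟨n, hn⟩ := ctx.exists_pairing ha hν
  have hle := hl ▸ ctx.B_self_le ha
  have hν0 := ctx.B_self_pos hν
  have hs := ctx.B_symm ν a
  have h1 : (2 : ℚ) ≤ n → a = ν := by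
    intro h
    rw [← sub_eq_zero]
    apply ctx.eq_zero_of_B_self_nonpos
    simp only [map_sub, LinearMap.sub_apply]
    nlinarith
  have h2 : (n : ℚ) ≤ -2 → a = -ν := by
    intro h
    rw [eq_neg_iff_add_eq_zero]
    apply ctx.eq_zero_of_B_self_nonpos
    simp only [map_add, LinearMap.add_apply]
    nlinarith
  refine ⟨n, hn, ?_, ?_, ?_, ?_⟩
  · by_contra! hc
    have := h2 (by exact_mod_cast hc.le)
    rw [this] at hn
    simp only [map_neg, LinearMap.neg_apply] at hn
    have : (n : ℚ) = -2 := by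
      apply mul_right_cancel₀ hν0.ne'
      linarith
    have : n = -2 := by exact_mod_cast this
    omega
  · by_contra! hc
    have := h1 (by exact_mod_cast hc.le)
    rw [this] at hn
    have : (n : ℚ) = 2 := by
      apply mul_right_cancel₀ hν0.ne'
      linarith
    have : n = 2 := by exact_mod_cast this
    omega
  · intro h; apply h2; rw [h]; norm_num
  · intro h; apply h1; rw [h]; norm_num

lemma add_ne_smul_simple {α : V} (hα : α ∈ ctx.simple) (n : ℕ) {γ γ' : V} (hγ : γ ∈ ctx.Pos)
    (hγ' : γ' ∈ ctx.Pos) (hne : γ ≠ α) : γ + γ' ≠ (n : ℚ) • α := by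
  induction n generalizing γ γ' with
  | zero =>
    intro h
    rw [Nat.cast_zero, zero_smul] at h
    exact ctx.ne_neg_of_pos hγ hγ' (eq_neg_of_add_eq_zero_left h)
  | succ n ih =>
    intro h
    have hαα := ctx.B_self_pos (ctx.pos_subset hα.1)
    have key : ∀ {β β' : V}, β ∈ ctx.Pos → β' ∈ ctx.Pos → β ≠ α →
        β + β' = ((n + 1 : ℕ) : ℚ) • α → ¬ 0 < ctx.B β α := by
      intro β β' hβ hβ' hβα hsum hpos
      have hd := ctx.sub_mem_of_B_pos (ctx.pos_subset hβ) (ctx.pos_subset hα.1) hpos hβα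
      have hp : β - α ∈ ctx.Pos := by
        refine (ctx.mem_pos_or_neg_pos _ hd).resolve_right fun hn => hα.2 ⟨β, hβ, -(β - α), hn, ?_⟩
        abel
      refine ih hp hβ' (fun h0 => ?_) ?_
      · have : (2 : ℚ) • α ∈ ctx.Δ := by
          rw [two_smul, ← sub_eq_iff_eq_add.mp h0]; exact ctx.pos_subset hβ
        rcases ctx.reduced α (ctx.pos_subset hα.1) 2 this with h | h <;> norm_num at h
      · rw [sub_add_eq_add_sub, hsum]; push_cast; rw [add_smul, one_smul, add_sub_cancel_right]
    have hne' : γ' ≠ α := by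
      rintro rfl
      have h1 : γ = (n : ℚ) • γ' := by
        rw [eq_sub_of_add_eq h]; push_cast; rw [add_smul, one_smul, add_sub_cancel_right]
      rcases ctx.reduced γ' (ctx.pos_subset hγ') n (h1 ▸ ctx.pos_subset hγ) with h2 | h2
      · rw [h2, one_smul] at h1; exact hne h1
      · linarith [(Nat.cast_nonneg n : (0 : ℚ) ≤ n)]
    have h1 := key hγ hγ' hne h
    have h2 := key hγ' hγ hne' (by rw [add_comm]; exact h)
    have h3 : ctx.B (γ + γ') α = (n + 1 : ℕ) * ctx.B α α := by rw [h]; simp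
    rw [map_add, LinearMap.add_apply] at h3
    have h4 : 0 < ((n + 1 : ℕ) : ℚ) * ctx.B α α := by positivity
    linarith [not_lt.mp h1, not_lt.mp h2]

/-- A simple reflection permutes the positive roots other than the simple root itself. -/
lemma simple_reflect_pos {α γ : V} (hα : α ∈ ctx.simple) (hγ : γ ∈ ctx.Pos) (hne : γ ≠ α)
    {q : ℚ} (hq : 2 * ctx.B γ α = q * ctx.B α α) : γ - q • α ∈ ctx.Pos := by
  have hαα := ctx.B_self_pos (ctx.pos_subset hα.1)
  obtain ⟨n, hn⟩ := ctx.exists_pairing (ctx.pos_subset hγ) (ctx.pos_subset hα.1)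
  obtain rfl : q = n := mul_right_cancel₀ hαα.ne' (hq.symm.trans hn)
  refine (ctx.mem_pos_or_neg_pos _ (ctx.reflect_mem_of_pairing (ctx.pos_subset hγ)
    (ctx.pos_subset hα.1) hn)).resolve_right fun hneg => ?_
  rcases Int.eq_nat_or_neg n with ⟨k, rfl | rfl⟩
  · exact ctx.add_ne_smul_simple hα k hγ hneg hne (by push_cast; abel)
  · have := ctx.multiset_eq_zero_of_sum_eq_zero
      (γ ::ₘ (-(γ - ((-(k : ℤ) : ℤ) : ℚ) • α)) ::ₘ Multiset.replicate k α) (by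
        intro x hx
        rcases Multiset.mem_cons.mp hx with rfl | hx
        · exact hγ
        rcases Multiset.mem_cons.mp hx with rfl | hx
        · exact hneg
        · rw [Multiset.eq_of_mem_replicate hx]; exact hα.1) (by
        simp only [Multiset.sum_cons, Multiset.sum_replicate, ← Nat.cast_smul_eq_nsmul ℚ]
        push_cast
        rw [neg_smul]; abel)
    simp at this

/-! ### The affine Weyl group -/

lemma refl_apply {a : V} (ha : a ∈ ctx.Δ) (m : ℚ) (x : V × ℚ × ℚ) :
    ctx.refl (a, m, 0) x =
      x - (2 * (ctx.B a x.1 + m * x.2.2) / ctx.B a a) • ((a, m, 0) : V × ℚ × ℚ) := by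
  have hB : ctx.Bhat (a, m, 0) (a, m, 0) = ctx.B a a := by simp [Bhat]
  have h0 : ctx.Bhat (a, m, 0) (a, m, 0) ≠ 0 := hB ▸ (ctx.B_self_pos ha).ne'
  rw [refl, dif_neg h0, Module.reflection_apply]
  congr 2
  rw [hB]
  simp only [LinearMap.smul_apply, smul_eq_mul, Bhat, LinearMap.mk₂_apply]
  ring

lemma mem_PosHat_iff {a : V} {k : ℤ} :
    ((a, (k : ℚ), (0 : ℚ)) : V × ℚ × ℚ) ∈ ctx.PosHat ↔
      (k = 0 ∧ a ∈ ctx.Pos) ∨ (1 ≤ k ∧ a ∈ ctx.Δ) := by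
  constructor
  · rintro (⟨b, hb, h⟩ | ⟨b, hb, l, hl, h⟩)
    · simp only [Prod.mk.injEq, Int.cast_eq_zero, and_true] at h
      exact .inl ⟨h.2, h.1 ▸ hb⟩
    · simp only [Prod.mk.injEq, Int.cast_inj, and_true] at h
      exact .inr ⟨h.2 ▸ hl, h.1 ▸ hb⟩
  · rintro (⟨rfl, h⟩ | ⟨hk, h⟩)
    · exact .inl ⟨a, h, by simp⟩
    · exact .inr ⟨a, h, k, hk, rfl⟩

lemma exists_of_mem_PosHat {β : V × ℚ × ℚ} (h : β ∈ ctx.PosHat) :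
    ∃ a ∈ ctx.Δ, ∃ k : ℤ, β = (a, (k : ℚ), 0) := by
  rcases h with ⟨b, hb, h⟩ | ⟨b, hb, l, hl, h⟩
  · exact ⟨b, ctx.pos_subset hb, 0, by simpa using h⟩
  · exact ⟨b, hb, l, h⟩

/-- `g` acts on `V̂` through the isometry `u` of `V` preserving the roots. -/
def ActsBy (g : (V × ℚ × ℚ) ≃ₗ[ℚ] (V × ℚ × ℚ)) (u : V ≃ₗ[ℚ] V) : Prop :=
  (∀ x, g x = (u x.1, x.2)) ∧ (∀ a b, ctx.B (u a) (u b) = ctx.B a b) ∧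
    ∀ a, u a ∈ ctx.Δ ↔ a ∈ ctx.Δ

variable {ctx}

lemma ActsBy.mul {g g' : (V × ℚ × ℚ) ≃ₗ[ℚ] (V × ℚ × ℚ)} {u u' : V ≃ₗ[ℚ] V}
    (h : ctx.ActsBy g u) (h' : ctx.ActsBy g' u') : ctx.ActsBy (g * g') (u * u') := by
  refine ⟨fun x => ?_, fun a b => ?_, fun a => ?_⟩
  · rw [LinearEquiv.mul_apply, h'.1, h.1]; rfl
  · simp only [LinearEquiv.mul_apply, h.2.1, h'.2.1]
  · simp only [LinearEquiv.mul_apply, h.2.2, h'.2.2]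

lemma ActsBy.inv {g : (V × ℚ × ℚ) ≃ₗ[ℚ] (V × ℚ × ℚ)} {u : V ≃ₗ[ℚ] V}
    (h : ctx.ActsBy g u) : ctx.ActsBy g⁻¹ u⁻¹ := by
  have hu : ∀ a, u (u⁻¹ a) = a := fun a => u.apply_symm_apply a
  refine ⟨fun x => ?_, fun a b => ?_, fun a => ?_⟩
  · apply g.injective
    refine (g.apply_symm_apply x).trans ?_
    rw [h.1]
    change x = (u (u⁻¹ x.1), x.2)
    rw [hu]
  · rw [← h.2.1, hu, hu]
  · rw [← h.2.2, hu]

variable (ctx)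

lemma actsBy_one : ctx.ActsBy 1 1 :=
  ⟨fun _ => rfl, fun _ _ => rfl, fun _ => Iff.rfl⟩

lemma exists_reflection {a : V} (ha : a ∈ ctx.Δ) :
    ∃ u : V ≃ₗ[ℚ] V, ctx.ActsBy (ctx.refl (a, (0 : ℚ), (0 : ℚ))) u ∧
      ∀ x, u x = x - (2 * ctx.B a x / ctx.B a a) • a := by
  have haa := (ctx.B_self_pos ha).ne'
  let u : V ≃ₗ[ℚ] V := Module.reflection (x := a) (f := (2 / ctx.B a a) • ctx.B a)
    (by simp only [LinearMap.smul_apply, smul_eq_mul]; field_simp)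
  have hu : ∀ x, u x = x - (2 * ctx.B a x / ctx.B a a) • a := by
    intro x
    change Module.reflection _ x = _
    rw [Module.reflection_apply]
    congr 2
    simp only [LinearMap.smul_apply, smul_eq_mul]
    ring
  have hmem : ∀ x, x ∈ ctx.Δ → u x ∈ ctx.Δ := by
    intro x hx
    rw [hu, ctx.B_symm a x]
    exact ctx.reflect_mem a ha x hx
  have hinv : ∀ x, u (u x) = x := fun x => Module.involutive_reflection _ x
  refine ⟨u, ⟨fun x => ?_, fun x y => ?_, fun x => ⟨fun h => ?_, hmem x⟩⟩, hu⟩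
  · rw [ctx.refl_apply ha, hu]
    ext <;> simp
  · simp only [hu, map_sub, LinearMap.sub_apply, map_smul, LinearMap.smul_apply, smul_eq_mul,
      ctx.B_symm x a]
    field_simp
    ring
  · exact hinv x ▸ hmem _ h

lemma exists_actsBy {g : (V × ℚ × ℚ) ≃ₗ[ℚ] (V × ℚ × ℚ)} (hg : g ∈ ctx.Wfin) :
    ∃ u, ctx.ActsBy g u := by
  induction hg using Subgroup.closure_induction with
  | mem g h =>
    obtain ⟨a, ha, rfl⟩ := h
    exact (ctx.exists_reflection ha).imp fun _ h => h.1
  | one => exact ⟨1, ctx.actsBy_one⟩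
  | mul g g' _ _ ih ih' =>
    obtain ⟨u, hu⟩ := ih
    obtain ⟨u', hu'⟩ := ih'
    exact ⟨u * u', hu.mul hu'⟩
  | inv g _ ih =>
    obtain ⟨u, hu⟩ := ih
    exact ⟨u⁻¹, hu.inv⟩

/-- The coroot lattice, as an additive submonoid of `V`. -/
def corootLattice : AddSubmonoid V := AddSubmonoid.closure {x | ∃ a ∈ ctx.Δ, x = ctx.coroot a}

lemma coroot_neg (a : V) : ctx.coroot (-a) = -ctx.coroot a := by simp [coroot]

lemma neg_mem_corootLattice {x : V} (hx : x ∈ ctx.corootLattice) : -x ∈ ctx.corootLattice := by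
  induction hx using AddSubmonoid.closure_induction with
  | mem x h =>
    obtain ⟨a, ha, rfl⟩ := h
    exact AddSubmonoid.subset_closure ⟨-a, ctx.neg_mem_Δ a ha, (ctx.coroot_neg a).symm⟩
  | zero => rw [neg_zero]; exact zero_mem _
  | add a b _ _ iha ihb => rw [neg_add]; exact add_mem iha ihb

variable {ctx} in
lemma ActsBy.map_coroot {g : (V × ℚ × ℚ) ≃ₗ[ℚ] (V × ℚ × ℚ)} {u : V ≃ₗ[ℚ] V}
    (h : ctx.ActsBy g u) (a : V) : u (ctx.coroot a) = ctx.coroot (u a) := by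
  simp [coroot, h.2.1]

variable {ctx} in
lemma ActsBy.map_mem_corootLattice {g : (V × ℚ × ℚ) ≃ₗ[ℚ] (V × ℚ × ℚ)} {u : V ≃ₗ[ℚ] V}
    (h : ctx.ActsBy g u) {x : V} (hx : x ∈ ctx.corootLattice) : u x ∈ ctx.corootLattice := by
  induction hx using AddSubmonoid.closure_induction with
  | mem x hx =>
    obtain ⟨a, ha, rfl⟩ := hx
    exact AddSubmonoid.subset_closure ⟨u a, (h.2.2 a).mpr ha, h.map_coroot a⟩
  | zero => simp
  | add a b _ _ iha ihb => rw [map_add]; exact add_mem iha ihb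

lemma exists_pairing_of_mem_corootLattice {x b : V} (hx : x ∈ ctx.corootLattice)
    (hb : b ∈ ctx.Δ) : ∃ n : ℤ, ctx.B x b = n := by
  induction hx using AddSubmonoid.closure_induction with
  | mem x hx =>
    obtain ⟨a, ha, rfl⟩ := hx
    obtain ⟨n, hn⟩ := ctx.exists_pairing hb ha
    refine ⟨n, ?_⟩
    have := (ctx.B_self_pos ha).ne'
    rw [coroot, map_smul, LinearMap.smul_apply, smul_eq_mul, ctx.B_symm a b]
    field_simp
    linarith
  | zero => exact ⟨0, by simp⟩
  | add y z _ _ ih ih' =>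
    obtain ⟨n, hn⟩ := ih
    obtain ⟨m, hm⟩ := ih'
    exact ⟨n + m, by rw [map_add, LinearMap.add_apply, hn, hm]; push_cast; rfl⟩

/-- The coroot lattice contains no nonzero minuscule vector. -/
lemma eq_zero_of_mem_corootLattice {x : V} (hx : x ∈ ctx.corootLattice)
    (hb : ∀ b ∈ ctx.Δ, -1 ≤ ctx.B x b) : x = 0 := by
  obtain ⟨m, hm, rfl⟩ := AddSubmonoid.exists_multiset_of_mem_closure hx
  clear hx
  induction hn : m.card generalizing m with
  | zero => rw [Multiset.card_eq_zero.mp hn, Multiset.sum_zero]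
  | succ n ih =>
    by_contra h0
    have hpos := ctx.B_posdef _ h0
    have hex : ∃ y ∈ m, 0 < ctx.B m.sum y := by
      by_contra! hc
      have : ctx.B m.sum m.sum ≤ 0 := by
        conv_lhs => rw [map_multiset_sum (ctx.B m.sum) m]
        refine (Multiset.sum_le_card_nsmul _ 0 fun z hz => ?_).trans_eq (nsmul_zero _)
        obtain ⟨y, hy, rfl⟩ := Multiset.mem_map.mp hz
        exact hc y hy
      linarith
    obtain ⟨y, hy, hypos⟩ := hex
    obtain ⟨a, ha, rfl⟩ := hm y hy
    obtain ⟨l, rfl⟩ := Multiset.exists_cons_of_mem hy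
    set x := (ctx.coroot a ::ₘ l).sum with hxdef
    have haa := ctx.B_self_pos ha
    have hxa : 0 < ctx.B x a := by
      rw [coroot, map_smul, smul_eq_mul] at hypos
      exact (pos_iff_pos_of_mul_pos hypos).mp (by positivity)
    have hxm : x ∈ ctx.corootLattice :=
      AddSubmonoid.multiset_sum_mem _ _ fun z hz => AddSubmonoid.subset_closure (hm z hz)
    obtain ⟨k, hk⟩ := ctx.exists_pairing_of_mem_corootLattice hxm ha
    have hle : ctx.B x a ≤ 1 := by
      have := hb (-a) (ctx.neg_mem_Δ a ha)
      rw [map_neg] at this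
      linarith
    have hk1 : ctx.B x a = 1 := by
      rw [hk] at hxa hle ⊢
      have h1 : 0 < k := by exact_mod_cast hxa
      have h2 : k ≤ 1 := by exact_mod_cast hle
      obtain rfl : k = 1 := by omega
      norm_num
    obtain ⟨u, hu, hux⟩ := ctx.exists_reflection ha
    have hl : l.sum = u x := by
      rw [hux, ctx.B_symm, hk1, mul_one, hxdef, Multiset.sum_cons, coroot, add_sub_cancel_left]
    have hl0 := ih l (fun z hz => hm z (Multiset.mem_cons_of_mem hz)) (fun b hb' => by
      have h1 := hb (u⁻¹ b) ((hu.inv.2.2 b).mpr hb')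
      rw [← hu.2.1] at h1
      rwa [hl, show b = u (u⁻¹ b) from (u.apply_symm_apply b).symm]) (by simpa using hn)
    rw [hl] at hl0
    exact h0 (by simpa using hl0)

lemma exists_affine_action {g : (V × ℚ × ℚ) ≃ₗ[ℚ] (V × ℚ × ℚ)} (hg : g ∈ ctx.What) :
    ∃ g₀ ∈ ctx.Wfin, ∃ u, ctx.ActsBy g₀ u ∧ ∃ x ∈ ctx.corootLattice,
      ∀ (a : V) (k : ℚ), g (a, k, 0) = (u a, k + ctx.B x (u a), 0) := by
  induction hg using Subgroup.closure_induction with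
  | mem g h =>
    obtain ⟨β, ⟨a, ha, m, rfl⟩, rfl⟩ := h
    obtain ⟨u, hu, hux⟩ := ctx.exists_reflection ha
    refine ⟨_, Subgroup.subset_closure ⟨a, ha, rfl⟩, u, hu, (m : ℚ) • ctx.coroot a, ?_, ?_⟩
    · rw [Int.cast_smul_eq_zsmul]
      have h1 : ctx.coroot a ∈ ctx.corootLattice := AddSubmonoid.subset_closure ⟨a, ha, rfl⟩
      rcases Int.eq_nat_or_neg m with ⟨k, rfl | rfl⟩
      · rw [natCast_zsmul]; exact nsmul_mem h1 k
      · rw [neg_smul, natCast_zsmul]; exact ctx.neg_mem_corootLattice (nsmul_mem h1 k)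
    · intro b k
      have haa := (ctx.B_self_pos ha).ne'
      rw [ctx.refl_apply ha, hux]
      ext
      · simp
      · simp only [coroot, Prod.snd_sub, Prod.fst_sub, Prod.smul_snd, Prod.smul_fst, smul_eq_mul,
          map_sub, map_smul, LinearMap.smul_apply]
        field_simp
        ring
      · simp
  | one => exact ⟨1, one_mem _, 1, ctx.actsBy_one, 0, zero_mem _, by simp⟩
  | mul g g' _ _ ih ih' =>
    obtain ⟨g₀, hg₀, u, hu, x, hx, h⟩ := ih
    obtain ⟨g₀', hg₀', u', hu', x', hx', h'⟩ := ih'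
    refine ⟨g₀ * g₀', mul_mem hg₀ hg₀', u * u', hu.mul hu', u x' + x,
      add_mem (hu.map_mem_corootLattice hx') hx, fun a k => ?_⟩
    rw [LinearEquiv.mul_apply, h', h]
    simp only [LinearEquiv.mul_apply, map_add, LinearMap.add_apply, hu.2.1, add_assoc]
  | inv g _ ih =>
    obtain ⟨g₀, hg₀, u, hu, x, hx, h⟩ := ih
    have hu' : ∀ a, u (u⁻¹ a) = a := fun a => u.apply_symm_apply a
    refine ⟨g₀⁻¹, inv_mem hg₀, u⁻¹, hu.inv, u⁻¹ (-x),
      hu.inv.map_mem_corootLattice (ctx.neg_mem_corootLattice hx), fun a k => ?_⟩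
    apply g.injective
    rw [h, hu.inv.2.1, hu']
    refine (g.apply_symm_apply _).trans ?_
    simp

/-! ### The minimal ideal with a given rootlet -/

variable {ctx} in
lemma ActsBy.mem_Nfin_iff {g : (V × ℚ × ℚ) ≃ₗ[ℚ] (V × ℚ × ℚ)} {u : V ≃ₗ[ℚ] V}
    (h : ctx.ActsBy g u) {γ : V} : γ ∈ ctx.Nfin g ↔ γ ∈ ctx.Pos ∧ -(u γ) ∈ ctx.Pos := by
  have h1 : -(g (ctx.emb γ)) = (-(u γ), ((0 : ℤ) : ℚ), 0) := by
    rw [h.1]; ext <;> simp [emb]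
  rw [Nfin, Set.mem_ofPred_eq, h1, mem_PosHat_iff]
  simp

lemma Nfin_finite (g : (V × ℚ × ℚ) ≃ₗ[ℚ] (V × ℚ × ℚ)) : (ctx.Nfin g).Finite :=
  (ctx.Δ_finite.subset ctx.pos_subset).subset fun _ h => h.1

/-- An element of minimal length in its left coset modulo the stabilizer of `θ` keeps the
positive roots orthogonal to `θ` positive. -/
lemma map_pos_of_minimal_length {g : (V × ℚ × ℚ) ≃ₗ[ℚ] (V × ℚ × ℚ)} {u : V ≃ₗ[ℚ] V}
    (hg : g ∈ ctx.Wfin) (hu : ctx.ActsBy g u)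
    (hmin : ∀ g' ∈ ctx.Wfin, g' (ctx.emb ctx.θ) = g (ctx.emb ctx.θ) →
      ctx.lenFin g ≤ ctx.lenFin g')
    {α : V} (hα : α ∈ ctx.Pos) (hθα : ctx.B ctx.θ α = 0) : u α ∈ ctx.Pos := by
  by_contra hcon
  obtain ⟨α, ⟨hα, hθα, hneg⟩, hαmin⟩ := ctx.exists_slt_minimal
    (S := {α | α ∈ ctx.Pos ∧ ctx.B ctx.θ α = 0 ∧ u α ∉ ctx.Pos})
    (fun x hx => ctx.pos_subset hx.1) ⟨α, hα, hθα, hcon⟩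
  have hsimple : α ∈ ctx.simple := by
    refine ⟨hα, ?_⟩
    rintro ⟨β, hβ, γ, hγ, rfl⟩
    have h1 := ctx.θ_dominant hβ
    have h2 := ctx.θ_dominant hγ
    rw [map_add] at hθα
    have h3 : u β ∈ ctx.Pos := by
      by_contra hc
      exact hαmin β ⟨hβ, by linarith, hc⟩ (ctx.slt_add hγ)
    have h4 : u γ ∈ ctx.Pos := by
      by_contra hc
      exact hαmin γ ⟨hγ, by linarith, hc⟩ (add_comm β γ ▸ ctx.slt_add hβ)
    refine hneg ?_
    have h5 := (hu.2.2 _).mpr (ctx.pos_subset hα)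
    rw [map_add] at h5 ⊢
    exact ctx.add_pos_mem _ h3 _ h4 h5
  have hαΔ := ctx.pos_subset hα
  have hαα := ctx.B_self_pos hαΔ
  obtain ⟨s, hs, hsx⟩ := ctx.exists_reflection hαΔ
  have hsθ : s ctx.θ = ctx.θ := by rw [hsx, ctx.B_symm, hθα]; simp
  have hsα : s α = -α := by
    rw [hsx, mul_div_cancel_right₀ _ hαα.ne', two_smul]; abel
  have hgs : g * ctx.refl (α, (0 : ℚ), (0 : ℚ)) ∈ ctx.Wfin :=
    mul_mem hg (Subgroup.subset_closure ⟨α, hαΔ, rfl⟩)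
  have hle := hmin _ hgs (by
    rw [LinearEquiv.mul_apply, hs.1]
    change g (s ctx.θ, _) = _
    rw [hsθ]; rfl)
  have huα : -(u α) ∈ ctx.Pos :=
    (ctx.mem_pos_or_neg_pos _ ((hu.2.2 α).mpr hαΔ)).resolve_left hneg
  have hlt := Set.ncard_sdiff_singleton_lt_of_mem (hu.mem_Nfin_iff.mpr ⟨hα, huα⟩)
    (ctx.Nfin_finite g)
  have hle' : (ctx.Nfin (g * ctx.refl (α, (0 : ℚ), (0 : ℚ)))).ncard ≤
      (ctx.Nfin g \ {α}).ncard := by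
    refine Set.ncard_le_ncard_of_injOn s ?_ s.injective.injOn ((ctx.Nfin_finite g).sdiff)
    intro γ hγ
    obtain ⟨hγ, hneg'⟩ := (hu.mul hs).mem_Nfin_iff.mp hγ
    rw [LinearEquiv.mul_apply] at hneg'
    have hne : γ ≠ α := by
      rintro rfl
      rw [hsα, map_neg, neg_neg] at hneg'
      exact hneg hneg'
    refine ⟨hu.mem_Nfin_iff.mpr ⟨?_, hneg'⟩, ?_⟩
    · rw [hsx]
      refine ctx.simple_reflect_pos hsimple hγ hne ?_
      rw [div_mul_cancel₀ _ hαα.ne', ctx.B_symm]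
    · intro h
      have h' : s γ = s (-α) := by rw [map_neg, hsα, neg_neg]; exact h
      exact ctx.ne_neg_of_pos hγ hα (s.injective h')
  exact absurd (hle.trans hle') (not_le.mpr hlt)

lemma B_eq_of_long_add_mem {μ β : V} (hμ : μ ∈ ctx.PosLong) (hβ : β ∈ ctx.Pos)
    (h : μ + β ∈ ctx.Δ) : 2 * ctx.B β μ = -ctx.B μ μ := by
  obtain ⟨n, hn, h1, -, h2, -⟩ := ctx.exists_long_pairing (ctx.pos_subset hβ)
    (ctx.pos_subset hμ.1) hμ.2
  have hle := ctx.B_self_le h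
  have hββ := ctx.B_self_pos (ctx.pos_subset hβ)
  have hμμ := ctx.B_self_pos (ctx.pos_subset hμ.1)
  rw [← hμ.2] at hle
  simp only [map_add, LinearMap.add_apply, ctx.B_symm μ β] at hle
  have hn0 : n < 0 := by
    by_contra hc
    have : (0 : ℚ) ≤ n := by exact_mod_cast not_lt.mp hc
    nlinarith
  have : n ≠ -2 := fun h => ctx.ne_neg_of_pos hβ hμ.1 (h2 h)
  obtain rfl : n = -1 := by omega
  rw [hn]; push_cast; ring

lemma long_add_mem {μ β : V} (hμ : μ ∈ ctx.PosLong) (hβ : β ∈ ctx.Pos)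
    (h : ctx.B β μ < 0) : μ + β ∈ ctx.Δ :=
  ctx.add_mem_of_B_neg (ctx.pos_subset hμ.1) (ctx.pos_subset hβ) (ctx.B_symm β μ ▸ h)
    (ctx.ne_neg_of_pos hμ.1 hβ)

/-- The roots `η` such that `u η - μ` is zero or a positive root. -/
def minIdeal (u : V ≃ₗ[ℚ] V) (μ : V) : Set V :=
  {η | η ∈ ctx.Δ ∧ (u η = μ ∨ u η - μ ∈ ctx.Pos)}

variable {ctx} in
lemma ActsBy.two_B_θ_of_sub_mem {g : (V × ℚ × ℚ) ≃ₗ[ℚ] (V × ℚ × ℚ)} {u : V ≃ₗ[ℚ] V} {μ η : V}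
    (hμ : μ ∈ ctx.PosLong) (hu : ctx.ActsBy g u) (huθ : u ctx.θ = μ)
    (hη : η ∈ ctx.Δ) (h : u η - μ ∈ ctx.Pos) : 2 * ctx.B η ctx.θ = ctx.B ctx.θ ctx.θ := by
  have h1 := ctx.B_eq_of_long_add_mem hμ h (by rw [add_sub_cancel]; exact (hu.2.2 η).mpr hη)
  rw [map_sub, LinearMap.sub_apply] at h1
  rw [← hu.2.1, huθ, ← hμ.2]
  linarith

variable {ctx} in
lemma ActsBy.B_θ_pos_of_mem_minIdeal {g : (V × ℚ × ℚ) ≃ₗ[ℚ] (V × ℚ × ℚ)} {u : V ≃ₗ[ℚ] V}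
    {μ η : V} (hμ : μ ∈ ctx.PosLong) (hu : ctx.ActsBy g u) (huθ : u ctx.θ = μ)
    (hη : η ∈ ctx.minIdeal u μ) : 0 < ctx.B η ctx.θ := by
  have hθ := ctx.B_self_pos ctx.θ_mem
  rcases hη.2 with h | h
  · rw [u.injective (h.trans huθ.symm)]; exact hθ
  · linarith [hu.two_B_θ_of_sub_mem hμ huθ hη.1 h]

lemma alpha0_mem_Δhat : ctx.alpha0 ∈ ctx.Δhat :=
  ⟨-ctx.θ, ctx.neg_mem_Δ _ ctx.θ_mem, 1, by simp [alpha0]⟩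

lemma refl_alpha0_apply {a : V} {n : ℤ} (hn : 2 * ctx.B a ctx.θ = n * ctx.B ctx.θ ctx.θ)
    (k : ℤ) : ctx.refl ctx.alpha0 (a, (k : ℚ), 0) =
      (a - (n : ℚ) • ctx.θ, ((k + n : ℤ) : ℚ), 0) := by
  have hθ := (ctx.B_self_pos ctx.θ_mem).ne'
  have h1 : 2 * (ctx.B (-ctx.θ) a + 1 * 0) / ctx.B (-ctx.θ) (-ctx.θ) = -n := by
    simp only [map_neg, LinearMap.neg_apply, neg_neg, mul_zero, add_zero, ctx.B_symm ctx.θ a]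
    rw [mul_neg, hn, neg_div, mul_div_cancel_right₀ _ hθ]
  rw [alpha0, ctx.refl_apply (ctx.neg_mem_Δ _ ctx.θ_mem)]
  simp only [h1]
  ext
  · simp [sub_eq_add_neg]
  · simp
  · simp

lemma exists_θ_pairing {a : V} (ha : a ∈ ctx.Δ) :
    ∃ n : ℤ, 2 * ctx.B a ctx.θ = n * ctx.B ctx.θ ctx.θ ∧ -2 ≤ n ∧ n ≤ 2 ∧
      (n = -2 → a = -ctx.θ) ∧ (n = 2 → a = ctx.θ) :=
  ctx.exists_long_pairing ha ctx.θ_mem rfl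

lemma reflect_θ_mem {a : V} (ha : a ∈ ctx.Δ) {n : ℤ}
    (hn : 2 * ctx.B a ctx.θ = n * ctx.B ctx.θ ctx.θ) : a - (n : ℚ) • ctx.θ ∈ ctx.Δ :=
  ctx.reflect_mem_of_pairing ha ctx.θ_mem hn

lemma neg_mem_PosHat_iff {a : V} {k : ℤ} :
    -((a, (k : ℚ), (0 : ℚ)) : V × ℚ × ℚ) ∈ ctx.PosHat ↔
      (k = 0 ∧ -a ∈ ctx.Pos) ∨ (k ≤ -1 ∧ a ∈ ctx.Δ) := by
  have h : -((a, (k : ℚ), (0 : ℚ)) : V × ℚ × ℚ) = (-a, ((-k : ℤ) : ℚ), 0) := by ext <;> simp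
  have h' : -a ∈ ctx.Δ ↔ a ∈ ctx.Δ :=
    ⟨fun h => by simpa using ctx.neg_mem_Δ _ h, ctx.neg_mem_Δ a⟩
  rw [h, mem_PosHat_iff, h', neg_eq_zero]
  have : 1 ≤ -k ↔ k ≤ -1 := by omega
  rw [this]

lemma mem_idealOf_iff {w : (V × ℚ × ℚ) ≃ₗ[ℚ] (V × ℚ × ℚ)} {γ : V} :
    γ ∈ ctx.idealOf w ↔ γ ∈ ctx.Pos ∧ -(w (-γ, ((1 : ℤ) : ℚ), 0)) ∈ ctx.PosHat := by
  have h : ctx.δhat - ctx.emb γ = (-γ, ((1 : ℤ) : ℚ), 0) := by ext <;> simp [δhat, emb]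
  rw [idealOf, Set.mem_ofPred_eq, Nhat, Set.mem_ofPred_eq, h, mem_PosHat_iff]
  refine ⟨fun h => ⟨h.1, h.2.2⟩, fun h => ⟨h.1, .inr ⟨le_rfl, ?_⟩, h.2⟩⟩
  exact ctx.neg_mem_Δ _ (ctx.pos_subset h.1)

section

variable {ctx}
variable {g : (V × ℚ × ℚ) ≃ₗ[ℚ] (V × ℚ × ℚ)} {u : V ≃ₗ[ℚ] V} {μ : V}

lemma ActsBy.apply_int (hu : ctx.ActsBy g u) (a : V) (k : ℤ) :
    g (a, (k : ℚ), 0) = (u a, (k : ℚ), 0) := hu.1 _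

lemma Wfin_le_What : ctx.Wfin ≤ ctx.What := by
  apply Subgroup.closure_mono
  rintro _ ⟨a, ha, rfl⟩
  exact ⟨_, ⟨a, ha, 0, by simp⟩, rfl⟩

lemma ActsBy.isMinuscule_mul_refl (hμ : μ ∈ ctx.PosLong) (hg : g ∈ ctx.Wfin)
    (hu : ctx.ActsBy g u) (huθ : u ctx.θ = μ)
    (hpos : ∀ α ∈ ctx.Pos, ctx.B ctx.θ α = 0 → u α ∈ ctx.Pos) :
    ctx.IsMinuscule (g * ctx.refl ctx.alpha0) := by
  refine ⟨mul_mem (Wfin_le_What hg) (Subgroup.subset_closure ⟨_, ctx.alpha0_mem_Δhat, rfl⟩), ?_⟩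
  rintro β ⟨hβ, hneg⟩
  obtain ⟨a, ha, k, rfl⟩ := ctx.exists_of_mem_PosHat hβ
  obtain ⟨n, hn, hn1, hn2, hn3, hn4⟩ := ctx.exists_θ_pairing ha
  have hθ := ctx.B_self_pos ctx.θ_mem
  rw [LinearEquiv.mul_apply, ctx.refl_alpha0_apply hn, hu.apply_int, neg_mem_PosHat_iff] at hneg
  rw [mem_PosHat_iff] at hβ
  suffices h : k = 1 ∧ -a ∈ ctx.Pos by
    refine ⟨-a, h.2, ?_⟩
    rw [h.1]
    ext <;> simp [δhat, emb]
  have hnegpos : n < 0 → -a ∈ ctx.Pos := by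
    intro h
    apply ctx.pos_of_B_θ_pos (ctx.neg_mem_Δ a ha)
    have : (n : ℚ) < 0 := by exact_mod_cast h
    rw [map_neg, LinearMap.neg_apply]
    nlinarith
  rcases hβ with ⟨rfl, hap⟩ | ⟨hk, -⟩
  · have hn0 : 0 ≤ n := by
      by_contra! hc
      exact ctx.pos_not_neg a hap (hnegpos hc)
    have : n = 0 := by omega
    subst this
    have h1 := hpos a hap (by rw [ctx.B_symm]; push_cast at hn; linarith)
    rcases hneg with ⟨-, h⟩ | ⟨h, -⟩
    · rw [Int.cast_zero, zero_smul, sub_zero] at h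
      exact absurd h (ctx.pos_not_neg _ h1)
    · omega
  · have hn0 : n < 0 := by omega
    refine ⟨?_, hnegpos hn0⟩
    by_contra hk1
    have h2 : n = -2 := by omega
    have h3 : k = 2 := by omega
    subst h2 h3
    rcases hneg with ⟨-, h⟩ | ⟨h, -⟩
    · rw [hn3 rfl] at h
      have : -u (-ctx.θ - ((-2 : ℤ) : ℚ) • ctx.θ) = -μ := by
        push_cast
        rw [neg_smul, two_smul, ← huθ]
        congr 2
        abel
      rw [this] at h
      exact ctx.pos_not_neg _ hμ.1 h
    · omega

lemma ActsBy.idealOf_mul_refl_subset (hu : ctx.ActsBy g u) (huθ : u ctx.θ = μ) :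
    ctx.idealOf (g * ctx.refl ctx.alpha0) ⊆ ctx.minIdeal u μ := by
  intro η hη
  obtain ⟨hηp, hneg⟩ := ctx.mem_idealOf_iff.mp hη
  have hηΔ := ctx.pos_subset hηp
  obtain ⟨n, hn, hn1, hn2, hn3, hn4⟩ := ctx.exists_θ_pairing hηΔ
  have hn' : 2 * ctx.B (-η) ctx.θ = ((-n : ℤ) : ℚ) * ctx.B ctx.θ ctx.θ := by
    rw [map_neg, LinearMap.neg_apply]; push_cast; linarith
  rw [LinearEquiv.mul_apply, ctx.refl_alpha0_apply hn', hu.apply_int, neg_mem_PosHat_iff] at hneg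
  refine ⟨hηΔ, ?_⟩
  by_cases h2 : n = 2
  · rw [hn4 h2]; exact .inl huθ
  have h1 : n = 1 := by omega
  subst h1
  rcases hneg with ⟨-, h⟩ | ⟨h, -⟩
  · refine .inr ?_
    have : -u (-η - ((-1 : ℤ) : ℚ) • ctx.θ) = u η - μ := by
      push_cast
      rw [neg_smul, one_smul, map_sub, map_neg, map_neg, huθ]
      abel
    rwa [this] at h
  · omega

lemma refl_alpha0_alpha0 : ctx.refl ctx.alpha0 ctx.alpha0 = -ctx.alpha0 := by
  have h := ctx.refl_alpha0_apply (a := -ctx.θ) (n := -2) (by simp) 1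
  have h' : ((-ctx.θ, ((1 : ℤ) : ℚ), 0) : V × ℚ × ℚ) = ctx.alpha0 := by simp [alpha0]
  rw [h'] at h
  rw [h]
  ext
  · simp [alpha0, two_smul]
  · simp [alpha0]
  · simp [alpha0]

lemma θ_mem_idealOf {w : (V × ℚ × ℚ) ≃ₗ[ℚ] (V × ℚ × ℚ)} (hμ : μ ∈ ctx.Δ)
    (hw : w ctx.alpha0 + ctx.δhat = ctx.emb μ) : ctx.θ ∈ ctx.idealOf w := by
  rw [mem_idealOf_iff]
  refine ⟨ctx.θ_pos, ?_⟩
  have h1 : ((-ctx.θ, ((1 : ℤ) : ℚ), 0) : V × ℚ × ℚ) = ctx.alpha0 := by simp [alpha0]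
  have h2 : w ctx.alpha0 = (μ, ((-1 : ℤ) : ℚ), 0) := by
    rw [eq_sub_of_add_eq hw]; ext <;> simp [δhat, emb]
  rw [h1, h2, neg_mem_PosHat_iff]
  exact .inr ⟨le_rfl, hμ⟩

lemma ActsBy.idealOf_mem_AbFiber (hμ : μ ∈ ctx.PosLong) (hg : g ∈ ctx.Wfin)
    (hu : ctx.ActsBy g u) (huθ : u ctx.θ = μ)
    (hpos : ∀ α ∈ ctx.Pos, ctx.B ctx.θ α = 0 → u α ∈ ctx.Pos) :
    ctx.idealOf (g * ctx.refl ctx.alpha0) ∈ ctx.AbFiber μ := by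
  have h : (g * ctx.refl ctx.alpha0) ctx.alpha0 + ctx.δhat = ctx.emb μ := by
    rw [LinearEquiv.mul_apply, refl_alpha0_alpha0, map_neg, hu.1]
    ext <;> simp [alpha0, δhat, emb, huθ]
  exact ⟨⟨_, θ_mem_idealOf (ctx.pos_subset hμ.1) h⟩, _, hu.isMinuscule_mul_refl hμ hg huθ hpos,
    rfl, h⟩

lemma ActsBy.eq_minIdeal_of_least (hμ : μ ∈ ctx.PosLong) (hg : g ∈ ctx.Wfin)
    (hu : ctx.ActsBy g u) (huθ : u ctx.θ = μ)
    (hpos : ∀ α ∈ ctx.Pos, ctx.B ctx.θ α = 0 → u α ∈ ctx.Pos)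
    (hmin : ∀ g' ∈ ctx.Wfin, g' (ctx.emb ctx.θ) = ctx.emb μ → ctx.lenFin g ≤ ctx.lenFin g')
    {I : Set V} (hI : I ∈ ctx.AbFiber μ) (hleast : ∀ J ∈ ctx.AbFiber μ, I ⊆ J) :
    I = ctx.minIdeal u μ := by
  have hμΔ := ctx.pos_subset hμ.1
  have hsub : I ⊆ ctx.minIdeal u μ :=
    (hleast _ (hu.idealOf_mem_AbFiber hμ hg huθ hpos)).trans (hu.idealOf_mul_refl_subset huθ)
  refine hsub.antisymm ?_
  obtain ⟨-, w, ⟨hw, hmn⟩, rfl, hwα⟩ := hI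
  have hα0 : ((-ctx.θ, ((1 : ℤ) : ℚ), 0) : V × ℚ × ℚ) = ctx.alpha0 := by simp [alpha0]
  have hwα0 : w ctx.alpha0 = (μ, ((-1 : ℤ) : ℚ), 0) := by
    rw [eq_sub_of_add_eq hwα]; ext <;> simp [δhat, emb]
  obtain ⟨t₀, ht₀, t, ht, x, hx, hv⟩ := ctx.exists_affine_action
    (mul_mem hw (Subgroup.subset_closure ⟨_, ctx.alpha0_mem_Δhat, rfl⟩) :
      w * ctx.refl ctx.alpha0 ∈ ctx.What)
  have hvα0 : (w * ctx.refl ctx.alpha0) ctx.alpha0 = (-μ, ((1 : ℤ) : ℚ), 0) := by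
    rw [LinearEquiv.mul_apply, refl_alpha0_alpha0, map_neg, hwα0]
    ext <;> simp
  have htθ : t ctx.θ = μ := by
    have h := hv (-ctx.θ) ((1 : ℤ) : ℚ)
    rw [hα0, hvα0] at h
    have := congrArg Prod.fst h
    simp only [map_neg, neg_inj] at this
    exact this.symm
  have hdich : ∀ {β : V × ℚ × ℚ}, β ∈ ctx.Δhat → w β ∉ ctx.PosHat → -(w β) ∈ ctx.PosHat := by
    rintro _ ⟨a, ha, k, rfl⟩ hn
    have hwv : w (a, (k : ℚ), 0) =
        (w * ctx.refl ctx.alpha0) (ctx.refl ctx.alpha0 (a, (k : ℚ), 0)) := by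
      rw [LinearEquiv.mul_apply]
      congr 1
      obtain ⟨n, hn, -⟩ := ctx.exists_θ_pairing ha
      have hn' : 2 * ctx.B (a - (n : ℚ) • ctx.θ) ctx.θ =
          ((-n : ℤ) : ℚ) * ctx.B ctx.θ ctx.θ := by
        simp only [map_sub, LinearMap.sub_apply, map_smul, LinearMap.smul_apply, smul_eq_mul]
        push_cast
        linarith
      rw [ctx.refl_alpha0_apply hn, ctx.refl_alpha0_apply hn']
      ext <;> simp
    obtain ⟨n, hn1, -⟩ := ctx.exists_θ_pairing ha
    have hr := ctx.reflect_θ_mem ha hn1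
    have htr := (ht.2.2 _).mpr hr
    obtain ⟨m, hm⟩ := ctx.exists_pairing_of_mem_corootLattice hx htr
    have hcast : (((k + n : ℤ) : ℚ) + (m : ℚ)) = ((k + n + m : ℤ) : ℚ) := by push_cast; ring
    rw [hwv, ctx.refl_alpha0_apply hn1, hv, hm, hcast] at hn ⊢
    rw [mem_PosHat_iff] at hn
    rw [neg_mem_PosHat_iff]
    rcases lt_trichotomy (k + n + m) 0 with h | h | h
    · exact .inr ⟨by omega, htr⟩
    · refine .inl ⟨h, (ctx.mem_pos_or_neg_pos _ htr).resolve_left fun h' => hn (.inl ⟨h, h'⟩)⟩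
    · exact absurd (.inr ⟨by omega, htr⟩) hn
  have hplus : ∀ a ∈ ctx.Δ, (w * ctx.refl ctx.alpha0) (a, ((1 : ℤ) : ℚ), 0) ∈ ctx.PosHat := by
    intro a ha
    obtain ⟨n, hn, hn1, hn2, hn3, hn4⟩ := ctx.exists_θ_pairing ha
    by_cases h2 : n = -2
    · rw [hn3 h2, hα0, hvα0, mem_PosHat_iff]
      exact .inr ⟨le_rfl, ctx.neg_mem_Δ _ hμΔ⟩
    have hr := ctx.reflect_θ_mem ha hn
    rw [LinearEquiv.mul_apply, ctx.refl_alpha0_apply hn]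
    by_contra hcon
    have hneg := hdich ⟨_, hr, _, rfl⟩ hcon
    have hp : ((a - (n : ℚ) • ctx.θ, ((1 + n : ℤ) : ℚ), 0) : V × ℚ × ℚ) ∈ ctx.PosHat := by
      rw [mem_PosHat_iff]
      by_cases h1 : n = -1
      · refine .inl ⟨by omega, ctx.pos_of_B_θ_pos hr ?_⟩
        subst h1
        have hθ := ctx.B_self_pos ctx.θ_mem
        simp only [map_sub, LinearMap.sub_apply, map_smul, LinearMap.smul_apply, smul_eq_mul]
        push_cast at hn ⊢
        linarith
      · exact .inr ⟨by omega, hr⟩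
    obtain ⟨γ, hγ, hγeq⟩ := hmn _ ⟨hp, hneg⟩
    have he : ctx.δhat - ctx.emb γ = (-γ, ((1 : ℤ) : ℚ), 0) := by ext <;> simp [δhat, emb]
    rw [hγeq, he] at hneg
    have hpos' := hu.B_θ_pos_of_mem_minIdeal hμ huθ
      (hsub (ctx.mem_idealOf_iff.mpr ⟨hγ, hneg⟩))
    rw [he] at hγeq
    simp only [Prod.mk.injEq, Int.cast_inj, and_true] at hγeq
    obtain rfl : n = 0 := by omega
    rw [Int.cast_zero, zero_smul, sub_zero] at hγeq
    rw [hγeq.1, map_neg, LinearMap.neg_apply] at hn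
    push_cast at hn
    linarith
  have hx0 : x = 0 := by
    refine ctx.eq_zero_of_mem_corootLattice hx fun b hb => ?_
    have htb : t (t⁻¹ b) = b := t.apply_symm_apply b
    obtain ⟨m, hm⟩ := ctx.exists_pairing_of_mem_corootLattice hx hb
    have h := hplus (t⁻¹ b) ((ht.inv.2.2 b).mpr hb)
    have hcast : (((1 : ℤ) : ℚ) + (m : ℚ)) = ((1 + m : ℤ) : ℚ) := by push_cast; ring
    rw [hv, htb, hm, hcast, mem_PosHat_iff] at h
    rw [hm]
    have : -1 ≤ m := by omega
    exact_mod_cast this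
  have hv' : ∀ (a : V) (k : ℤ), (w * ctx.refl ctx.alpha0) (a, (k : ℚ), 0) = (t a, (k : ℚ), 0) := by
    intro a k
    rw [hv, hx0]; simp
  have hθ := ctx.B_self_pos ctx.θ_mem
  have hNsub : ctx.Nfin t₀ ⊆ ctx.Nfin g := by
    intro γ hγ
    obtain ⟨hγp, hγn⟩ := ht.mem_Nfin_iff.mp hγ
    have hγΔ := ctx.pos_subset hγp
    refine hu.mem_Nfin_iff.mpr ⟨hγp, ?_⟩
    obtain ⟨n, hn, -⟩ := ctx.exists_θ_pairing hγΔ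
    have hn0 : 0 ≤ n := by
      by_contra! hc
      have h1 := ctx.θ_dominant hγp
      rw [ctx.B_symm] at h1
      have : (n : ℚ) < 0 := by exact_mod_cast hc
      nlinarith
    have hr := ctx.reflect_θ_mem hγΔ hn
    have hneg : -(w (γ - (n : ℚ) • ctx.θ, ((0 + n : ℤ) : ℚ), 0)) ∈ ctx.PosHat := by
      rw [← ctx.refl_alpha0_apply hn, ← LinearEquiv.mul_apply, hv', neg_mem_PosHat_iff]
      exact .inl ⟨rfl, hγn⟩
    have hp : ((γ - (n : ℚ) • ctx.θ, ((0 + n : ℤ) : ℚ), 0) : V × ℚ × ℚ) ∈ ctx.PosHat := by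
      rw [mem_PosHat_iff]
      rcases hn0.eq_or_lt with h | h
      · refine .inl ⟨by omega, ?_⟩
        rw [← h, Int.cast_zero, zero_smul, sub_zero]
        exact hγp
      · exact .inr ⟨by omega, hr⟩
    obtain ⟨η, hη, hηeq⟩ := hmn _ ⟨hp, hneg⟩
    have he : ctx.δhat - ctx.emb η = (-η, ((1 : ℤ) : ℚ), 0) := by ext <;> simp [δhat, emb]
    rw [hηeq, he] at hneg
    have hηm := hsub (ctx.mem_idealOf_iff.mpr ⟨hη, hneg⟩)
    rw [he] at hηeq
    simp only [Prod.mk.injEq, Int.cast_inj, and_true] at hηeq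
    obtain rfl : n = 1 := by omega
    rw [Int.cast_one, one_smul] at hηeq
    have hη' : η = ctx.θ - γ := by rw [← neg_eq_iff_eq_neg.mpr hηeq.1]; abel
    have huη : u η - μ = -(u γ) := by rw [hη', map_sub, huθ]; abel
    rcases hηm.2 with h | h
    · exfalso
      rw [h, sub_self, eq_comm, neg_eq_zero, map_eq_zero_iff _ u.injective] at huη
      exact ctx.ne_zero_of_mem hγΔ huη
    · exact huη ▸ h
  have hNeq : ctx.Nfin t₀ = ctx.Nfin g := by
    refine Set.eq_of_subset_of_ncard_le hNsub (hmin t₀ ht₀ ?_) (ctx.Nfin_finite g)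
    rw [ht.1]
    simp [emb, htθ]
  rintro η ⟨hηΔ, hη | hη⟩
  · rw [u.injective (hη.trans huθ.symm)]
    exact θ_mem_idealOf hμΔ hwα
  · have hBη := hu.two_B_θ_of_sub_mem hμ huθ hηΔ hη
    have hγn : 2 * ctx.B (ctx.θ - η) ctx.θ = ((1 : ℤ) : ℚ) * ctx.B ctx.θ ctx.θ := by
      rw [map_sub, LinearMap.sub_apply]; push_cast; linarith
    have hγΔ : ctx.θ - η ∈ ctx.Δ := by
      have h := ctx.reflect_θ_mem hηΔ (n := 1) (by rw [hBη]; simp)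
      have := ctx.neg_mem_Δ _ h
      rwa [Int.cast_one, one_smul, neg_sub] at this
    have hγp : ctx.θ - η ∈ ctx.Pos := ctx.pos_of_B_θ_pos hγΔ (by push_cast at hγn; linarith)
    have hγN : ctx.θ - η ∈ ctx.Nfin g := by
      refine hu.mem_Nfin_iff.mpr ⟨hγp, ?_⟩
      rwa [map_sub, huθ, neg_sub]
    rw [← hNeq, ht.mem_Nfin_iff] at hγN
    refine ctx.mem_idealOf_iff.mpr ⟨ctx.pos_of_B_θ_pos hηΔ (by linarith), ?_⟩
    have h := ctx.refl_alpha0_apply hγn 0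
    have h' : ((ctx.θ - η - ((1 : ℤ) : ℚ) • ctx.θ, ((0 + 1 : ℤ) : ℚ), 0) : V × ℚ × ℚ) =
        (-η, ((1 : ℤ) : ℚ), 0) := by ext <;> simp
    rw [← h', ← h, ← LinearEquiv.mul_apply, hv', neg_mem_PosHat_iff]
    exact .inl ⟨rfl, hγN.2⟩

lemma exists_pos_B_neg (hμ : μ ∈ ctx.PosLong) (hμθ : μ ≠ ctx.θ) :
    ∃ β ∈ ctx.Pos, ctx.B β μ < 0 := by
  by_contra! hc
  have h := ctx.B_nonneg_of_mem_closure (x := μ) (fun a ha => ctx.B_symm a μ ▸ hc a ha)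
    (ctx.θ_highest μ (ctx.pos_subset hμ.1))
  apply hμθ
  rw [← sub_eq_zero]
  apply ctx.eq_zero_of_B_self_nonpos
  have hl := hμ.2
  simp only [map_sub, LinearMap.sub_apply, ctx.B_symm ctx.θ μ] at h ⊢
  linarith

lemma ActsBy.mem_minIdeal_of_add (hu : ctx.ActsBy g u) {β η : V} (hβ : β ∈ ctx.Pos)
    (h : μ + β ∈ ctx.Δ) (hη : u η = μ + β) : η ∈ ctx.minIdeal u μ :=
  ⟨(hu.2.2 η).mp (hη ▸ h), .inr (by rwa [hη, add_sub_cancel_left])⟩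

/-- If `β` is positive and `μ + β` is a root, then the preimage of `β` is negative. -/
lemma ActsBy.neg_pos_of_add_mem (hμ : μ ∈ ctx.PosLong) (hu : ctx.ActsBy g u)
    (huθ : u ctx.θ = μ) {β ν : V} (hβ : β ∈ ctx.Pos) (h : μ + β ∈ ctx.Δ) (hν : u ν = β) :
    -ν ∈ ctx.Pos := by
  have h1 := ctx.B_eq_of_long_add_mem hμ hβ h
  have h2 := ctx.B_self_pos (ctx.pos_subset hμ.1)
  refine ctx.pos_of_B_θ_pos (ctx.neg_mem_Δ _ ((hu.2.2 ν).mp (hν ▸ ctx.pos_subset hβ))) ?_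
  rw [← hu.2.1, huθ, map_neg, hν, map_neg, LinearMap.neg_apply]
  linarith

lemma ActsBy.isGenerator_minIdeal_iff (hμ : μ ∈ ctx.PosLong) (hμθ : μ ≠ ctx.θ)
    (hu : ctx.ActsBy g u) (huθ : u ctx.θ = μ)
    (hpos : ∀ α ∈ ctx.Pos, ctx.B ctx.θ α = 0 → u α ∈ ctx.Pos) {γ : V} :
    ctx.IsGenerator (ctx.minIdeal u μ) γ ↔
      ∃ α ∈ ctx.simple, μ + α ∈ ctx.Δ ∧ u γ = μ + α := by
  have hui : ∀ a, u (u⁻¹ a) = a := fun a => u.apply_symm_apply a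
  have hμμ := ctx.B_self_pos (ctx.pos_subset hμ.1)
  constructor
  · rintro ⟨⟨hγΔ, hγ⟩, hgen⟩
    rcases hγ with hγ | hγ
    · exfalso
      obtain ⟨β, hβ, hneg⟩ := exists_pos_B_neg hμ hμθ
      have hadd := ctx.long_add_mem hμ hβ hneg
      refine hgen _ (hu.neg_pos_of_add_mem hμ huθ hβ hadd (hui β)) ?_
      refine hu.mem_minIdeal_of_add hβ hadd ?_
      rw [sub_neg_eq_add, map_add, hui, hγ]
    · have huγ : u γ = μ + (u γ - μ) := by abel
      have hadd : μ + (u γ - μ) ∈ ctx.Δ := huγ ▸ (hu.2.2 γ).mpr hγΔ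
      refine ⟨u γ - μ, ⟨hγ, ?_⟩, hadd, huγ⟩
      rintro ⟨β₁, hβ₁, β₂, hβ₂, hsum⟩
      have hB := ctx.B_eq_of_long_add_mem hμ hγ hadd
      have key : ∀ {β₁ β₂ : V}, β₁ ∈ ctx.Pos → β₂ ∈ ctx.Pos → u γ - μ = β₁ + β₂ →
          ¬ ctx.B β₁ μ < 0 := by
        intro β₁ β₂ hβ₁ hβ₂ hsum hneg
        have hadd₁ := ctx.long_add_mem hμ hβ₁ hneg
        have hB₁ := ctx.B_eq_of_long_add_mem hμ hβ₁ hadd₁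
        have hB₂ : ctx.B β₂ μ = 0 := by
          rw [hsum, map_add, LinearMap.add_apply] at hB
          linarith
        have hνΔ : u⁻¹ β₂ ∈ ctx.Δ := (hu.inv.2.2 β₂).mpr (ctx.pos_subset hβ₂)
        have hν : u⁻¹ β₂ ∈ ctx.Pos := by
          refine (ctx.mem_pos_or_neg_pos _ hνΔ).resolve_right fun hn => ?_
          have h1 := hpos _ hn (by
            rw [ctx.B_symm, ← hu.2.1, huθ, map_neg, hui, map_neg, LinearMap.neg_apply, hB₂,
              neg_zero])
          rw [map_neg, hui] at h1
          exact ctx.pos_not_neg _ hβ₂ h1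
        refine hgen _ hν (hu.mem_minIdeal_of_add hβ₁ hadd₁ ?_)
        rw [map_sub, hui, huγ, hsum]
        abel
      have h1 := key hβ₁ hβ₂ hsum
      have h2 := key hβ₂ hβ₁ (hsum.trans (add_comm _ _))
      rw [hsum, map_add, LinearMap.add_apply] at hB
      linarith
  · rintro ⟨β, hβ, hadd, hγ⟩
    have hγm := hu.mem_minIdeal_of_add hβ.1 hadd hγ
    refine ⟨hγm, fun ν hν hm => ?_⟩
    have hγθ := hu.two_B_θ_of_sub_mem hμ huθ hγm.1
      (by rw [hγ, add_sub_cancel_left]; exact hβ.1)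
    have huν : u (γ - ν) - μ = β - u ν := by rw [map_sub, hγ]; abel
    rcases hm.2 with h | h
    · rw [h, sub_self, eq_comm, sub_eq_zero] at huν
      exact ctx.pos_not_neg _ hν (hu.neg_pos_of_add_mem hμ huθ hβ.1 hadd huν.symm)
    · have hm1 := hu.two_B_θ_of_sub_mem hμ huθ hm.1 h
      rw [map_sub, LinearMap.sub_apply] at hm1
      have huνp := hpos ν hν (by rw [ctx.B_symm]; linarith)
      exact hβ.2 ⟨_, h, _, huνp, by rw [huν, sub_add_cancel]⟩

end

end RootSystemCtx
/-- Proposition `obraz`: for `μ ≠ θ`, the generators of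
`I(μ)_min` are exactly the roots `w_μ⁻¹(μ + α)` for `α ∈ Π` with `μ + α ∈ Δ`,
and `α ↦ w_μ⁻¹(μ + α)` is a bijection onto the set of generators. -/
theorem statement_12 {V : Type*} [AddCommGroup V] [Module ℚ V] (ctx : RootSystemCtx V)
    (μ : V) (hμ : μ ∈ ctx.PosLong) (hμθ : μ ≠ ctx.θ)
    (wμ : (V × ℚ × ℚ) ≃ₗ[ℚ] (V × ℚ × ℚ)) (hwμ : wμ ∈ ctx.Wfin)
    (hwθ : wμ (ctx.emb ctx.θ) = ctx.emb μ)
    (hminlen : ∀ u ∈ ctx.Wfin, u (ctx.emb ctx.θ) = ctx.emb μ →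
      ctx.lenFin wμ ≤ ctx.lenFin u)
    (Imin : Set V) (hImin : Imin ∈ ctx.AbFiber μ)
    (hleast : ∀ I ∈ ctx.AbFiber μ, Imin ⊆ I) :
    (∀ γ : V, ctx.IsGenerator Imin γ ↔
        ∃ α ∈ ctx.simple, μ + α ∈ ctx.Δ ∧ ctx.emb γ = wμ⁻¹ (ctx.emb (μ + α))) ∧
    Set.BijOn (fun α : V => wμ⁻¹ (ctx.emb (μ + α)))
      {α | α ∈ ctx.simple ∧ μ + α ∈ ctx.Δ}
      (ctx.emb '' {γ | ctx.IsGenerator Imin γ}) := by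
  obtain ⟨u, hu⟩ := ctx.exists_actsBy hwμ
  have huθ : u ctx.θ = μ := congrArg Prod.fst ((hu.1 _).symm.trans hwθ)
  have hpos : ∀ α ∈ ctx.Pos, ctx.B ctx.θ α = 0 → u α ∈ ctx.Pos := fun α hα h =>
    ctx.map_pos_of_minimal_length hwμ hu (fun g' hg' h' => hminlen g' hg' (h'.trans hwθ)) hα h
  obtain rfl := hu.eq_minIdeal_of_least hμ hwμ huθ hpos hminlen hImin hleast
  have hiff : ∀ γ α : V, ctx.emb γ = wμ⁻¹ (ctx.emb (μ + α)) ↔ u γ = μ + α := by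
    intro γ α
    change _ = wμ.symm _ ↔ _
    rw [LinearEquiv.eq_symm_apply, hu.1]
    simp [RootSystemCtx.emb]
  have hgen : ∀ γ : V, ctx.IsGenerator (ctx.minIdeal u μ) γ ↔
      ∃ α ∈ ctx.simple, μ + α ∈ ctx.Δ ∧ ctx.emb γ = wμ⁻¹ (ctx.emb (μ + α)) := by
    intro γ
    simp only [hiff]
    exact hu.isGenerator_minIdeal_iff hμ hμθ huθ hpos
  refine ⟨hgen, ?_, ?_, ?_⟩
  · rintro α ⟨hα, hadd⟩
    have h := (hiff (u⁻¹ (μ + α)) α).mpr (u.apply_symm_apply _)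
    exact ⟨u⁻¹ (μ + α), (hgen _).mpr ⟨α, hα, hadd, h⟩, h⟩
  · intro α _ β _ h
    have := congrArg Prod.fst (wμ⁻¹.injective h)
    exact add_left_cancel this
  · rintro _ ⟨γ, hγ, rfl⟩
    obtain ⟨α, hα, hadd, h⟩ := (hgen γ).mp hγ
    exact ⟨α, ⟨hα, hadd⟩, h.symm⟩
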